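/- For n ≥ 1, the number of Fishburn permutations of length n avoiding the classical patterns 321 and 21354 equals 2^n − C(n,2) − 1. -/

import Mathlib

/-- A permutation `π` of `Fin n` contains the classical pattern `p` (given as a
function `Fin k → ℕ` listing the pattern's entries). -/
def Contains {n k : ℕ} (π : Equiv.Perm (Fin n)) (p : Fin k → ℕ) : Prop :=
  ∃ f : Fin k → Fin n, StrictMono f ∧ ∀ i j, p i < p j ↔ π (f i) < π (f j)

/-- Classical pattern avoidance. -/
def Avoids {n k : ℕ} (π : Equiv.Perm (Fin n)) (p : Fin k → ℕ) : Prop :=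
  ¬ Contains π p

/-- A permutation is Fishburn if there are no indices `i < j` with
`π i, π (i+1), π j` forming a 231 pattern and `π i = π j + 1`. -/
def IsFishburn {n : ℕ} (π : Equiv.Perm (Fin n)) : Prop :=
  ¬ ∃ (i j : ℕ) (hij : i + 1 < j) (hj : j < n),
      π ⟨i, by omega⟩ < π ⟨i + 1, by omega⟩ ∧
      π ⟨j, hj⟩ < π ⟨i, by omega⟩ ∧
      (π ⟨i, by omega⟩ : ℕ) = (π ⟨j, hj⟩ : ℕ) + 1

open Finset

section Patterns

variable {n : ℕ} {π : Equiv.Perm (Fin n)}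

lemma contains_321_iff :
    Contains π ![3, 2, 1] ↔ ∃ i j k, i < j ∧ j < k ∧ π k < π j ∧ π j < π i := by
  constructor
  · rintro ⟨f, hf, h⟩
    exact ⟨f 0, f 1, f 2, hf (by decide), hf (by decide), (h 2 1).1 (by decide),
      (h 1 0).1 (by decide)⟩
  · rintro ⟨i, j, k, hij, hjk, h₁, h₂⟩
    refine ⟨![i, j, k], ?_, ?_⟩
    · rw [Fin.strictMono_iff_lt_succ]
      simp [Fin.forall_fin_succ, hij, hjk]
    · simp only [Fin.forall_fin_succ]
      simp [h₁, h₂, h₁.trans h₂, h₁.le, h₂.le, (h₁.trans h₂).le]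

lemma contains_21354_iff :
    Contains π ![2, 1, 3, 5, 4] ↔ ∃ a b c d e, a < b ∧ b < c ∧ c < d ∧ d < e ∧
      π b < π a ∧ π a < π c ∧ π c < π e ∧ π e < π d := by
  constructor
  · rintro ⟨f, hf, h⟩
    exact ⟨f 0, f 1, f 2, f 3, f 4, hf (by decide), hf (by decide), hf (by decide),
      hf (by decide), (h 1 0).1 (by decide), (h 0 2).1 (by decide), (h 2 4).1 (by decide),
      (h 4 3).1 (by decide)⟩
  · rintro ⟨a, b, c, d, e, hab, hbc, hcd, hde, h₁, h₂, h₃, h₄⟩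
    refine ⟨![a, b, c, d, e], ?_, ?_⟩
    · rw [Fin.strictMono_iff_lt_succ]
      simp [Fin.forall_fin_succ, hab, hbc, hcd, hde]
    · simp only [Fin.forall_fin_succ]
      simp
      grind

lemma isFishburn_iff :
    IsFishburn π ↔ ∀ i i' j : Fin n, (i' : ℕ) = i + 1 → i' < j → π i < π i' →
      (π i : ℕ) = π j + 1 → False := by
  constructor
  · rintro h ⟨i, hi⟩ ⟨i', hi'⟩ ⟨j, hj⟩ rfl hij h₁ h₂
    exact h ⟨i, j, hij, hj, h₁, by rw [Fin.lt_def]; omega, h₂⟩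
  · rintro h ⟨i, j, hij, hj, h₁, -, h₂⟩
    exact h ⟨i, by omega⟩ ⟨i + 1, by omega⟩ ⟨j, hj⟩ rfl hij h₁ h₂

end Patterns

/-- `π` is the standardization of the word `w`. -/
def IsStandardization {n : ℕ} (w : Fin n → Fin 4) (π : Equiv.Perm (Fin n)) : Prop :=
  ∀ i j, i < j → (π i < π j ↔ w i ≤ w j)

/-- The standardization of a word. -/
def standardize {n : ℕ} (w : Fin n → Fin 4) : Equiv.Perm (Fin n) :=
  (Tuple.sort w)⁻¹

section Standardization

variable {n : ℕ} {w w' : Fin n → Fin 4} {π : Equiv.Perm (Fin n)}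

lemma IsStandardization.lt_iff (h : IsStandardization w π) {i j : Fin n} (hij : i < j) :
    π j < π i ↔ w j < w i := by
  have h₁ := h i j hij
  have h₂ : π i ≠ π j := fun h => hij.ne (π.injective h)
  grind

lemma IsStandardization.lt_of_lt (h : IsStandardization w π) {i j : Fin n} (hij : w i < w j) :
    π i < π j := by
  rcases lt_trichotomy i j with h' | rfl | h'
  · exact (h i j h').2 hij.le
  · exact absurd hij (lt_irrefl _)
  · exact (h.lt_iff h').2 hij

lemma isStandardization_iff_eq : IsStandardization w π ↔ π = standardize w := by
  rw [standardize, ← inv_eq_iff_eq_inv, Tuple.eq_sort_iff]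
  constructor
  · intro h
    refine ⟨fun x y hxy => ?_, fun i j hij he => ?_⟩
    · by_contra! hlt
      have := h.lt_of_lt hlt
      simp at this
      exact absurd hxy this.not_ge
    · by_contra! hle
      rcases hle.lt_or_eq with hlt | heq
      · have := (h _ _ hlt).2 he.ge
        simp at this
        exact absurd hij this.asymm
      · exact hij.ne' (π⁻¹.injective heq)
  · rintro ⟨h₁, h₂⟩ i j hij
    constructor
    · intro h
      simpa using h₁ h.le
    · intro hw
      by_contra! hle
      have hlt : π j < π i := lt_of_le_of_ne hle fun h => hij.ne' (π.injective h)
      have h₃ := h₁ hlt.le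
      simp at h₃
      have h₄ := h₂ _ _ hlt (by simpa using le_antisymm h₃ hw)
      simp at h₄
      exact absurd hij h₄.asymm

end Standardization

/-- Words `0ᵃ 1 0 W 2ᵗ 3ᵉ` with `W` over `{0, 3}` such that, if `0 < t`, then `W` contains a `3`
and its first `3` is not followed by another `3`; or all-zero words. -/
structure IsCode {n : ℕ} (w : Fin n → Fin 4) : Prop where
  one_unique : ∀ i j, w i = 1 → w j = 1 → i = j
  before_one : ∀ i j, w i = 1 → j < i → w j = 0
  exists_one : ∀ i, w i ≠ 0 → ∃ a ≤ i, w a = 1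
  after_one : ∀ a, w a = 1 → ∃ b : Fin n, (b : ℕ) = a + 1 ∧ w b = 0
  before_two : ∀ i, w i = 2 → ∃ j < i, w j = 3
  after_two : ∀ i j, i < j → w i = 2 → w j ≠ 0
  two_three_two : ∀ i j k, i < j → j < k → w i = 2 → w j = 3 → w k ≠ 2
  first_three : ∀ u v i : Fin n, (v : ℕ) = u + 1 → w u = 3 → w v = 3 → w i = 2 → ∃ j < u, w j = 3

lemma isCode_iff {n : ℕ} (w : Fin n → Fin 4) : IsCode w ↔
    (∀ i j, w i = 1 → w j = 1 → i = j) ∧ (∀ i j, w i = 1 → j < i → w j = 0) ∧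
    (∀ i, w i ≠ 0 → ∃ a ≤ i, w a = 1) ∧ (∀ a, w a = 1 → ∃ b : Fin n, (b : ℕ) = a + 1 ∧ w b = 0) ∧
    (∀ i, w i = 2 → ∃ j < i, w j = 3) ∧ (∀ i j, i < j → w i = 2 → w j ≠ 0) ∧
    (∀ i j k, i < j → j < k → w i = 2 → w j = 3 → w k ≠ 2) ∧
    (∀ u v i : Fin n, (v : ℕ) = u + 1 → w u = 3 → w v = 3 → w i = 2 → ∃ j < u, w j = 3) :=
  ⟨fun ⟨h₁, h₂, h₃, h₄, h₅, h₆, h₇, h₈⟩ => ⟨h₁, h₂, h₃, h₄, h₅, h₆, h₇, h₈⟩,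
    fun ⟨h₁, h₂, h₃, h₄, h₅, h₆, h₇, h₈⟩ => ⟨h₁, h₂, h₃, h₄, h₅, h₆, h₇, h₈⟩⟩

namespace IsCode

variable {n : ℕ} {w w' : Fin n → Fin 4} {π : Equiv.Perm (Fin n)}

lemma isFishburn (hw : IsCode w) (h : IsStandardization w π) : IsFishburn π := by
  rw [isFishburn_iff]
  intro i i' j hi hij h₁ h₂
  have hii : i < i' := by rw [Fin.lt_def]; omega
  have hw₁ := (h i i' hii).1 h₁
  have hw₂ := (h.lt_iff (hii.trans hij)).1 (by rw [Fin.lt_def]; omega)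
  have gap : ∀ k, π j < π k → π k < π i → False := fun k h₃ h₄ => by
    rw [Fin.lt_def] at h₃ h₄; omega
  have hj1 : w j ≠ 1 := fun hj => by
    have := hw.before_one j i hj (hii.trans hij)
    grind
  have cases4 : ∀ x : Fin 4, x = 0 ∨ x = 1 ∨ x = 2 ∨ x = 3 := by decide
  rcases cases4 (w i) with hi0 | hi1 | hi2 | hi3
  · grind
  · obtain ⟨b, hb, hb0⟩ := hw.after_one i hi1
    have : b = i' := Fin.ext (by omega)
    grind
  · have := hw.after_two i j (hii.trans hij) hi2
    grind
  · have hi'3 : w i' = 3 := by grind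
    rcases cases4 (w j) with hj0 | hj1' | hj2 | hj3
    · obtain ⟨a, -, ha⟩ := hw.exists_one i (by grind)
      exact gap a (h.lt_of_lt (by grind)) (h.lt_of_lt (by grind))
    · exact hj1 hj1'
    · obtain ⟨u, hu, hu3⟩ := hw.first_three i i' j hi hi3 hi'3 hj2
      exact gap u (h.lt_of_lt (by grind)) ((h u i hu).2 (by grind))
    · grind

lemma avoids_321 (hw : IsCode w) (h : IsStandardization w π) : Avoids π ![3, 2, 1] := by
  rw [Avoids, contains_321_iff]
  rintro ⟨i, j, k, hij, hjk, h₁, h₂⟩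
  rw [h.lt_iff hij] at h₂
  rw [h.lt_iff hjk] at h₁
  have := hw.before_one j i
  have := hw.before_one k i
  have := hw.after_two j k hjk
  grind

lemma avoids_21354 (hw : IsCode w) (h : IsStandardization w π) :
    Avoids π ![2, 1, 3, 5, 4] := by
  rw [Avoids, contains_21354_iff]
  rintro ⟨a, b, c, d, e, hab, hbc, hcd, hde, h₁, h₂, h₃, h₄⟩
  rw [h.lt_iff hab] at h₁
  rw [h a c (hab.trans hbc)] at h₂
  rw [h c e (hcd.trans hde)] at h₃
  rw [h.lt_iff hde] at h₄
  have := hw.before_one c a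
  have := hw.before_one e a
  have := hw.two_three_two c d e hcd hde
  grind

lemma one_iff (hw : IsCode w) (h : IsStandardization w π) (a : Fin n) :
    w a = 1 ↔ (∃ b > a, π b < π a) ∧ ∀ i < a, ∀ j > i, π i < π j := by
  constructor
  · intro ha
    obtain ⟨b, hb, hb0⟩ := hw.after_one a ha
    have hab : a < b := by rw [Fin.lt_def]; omega
    refine ⟨⟨b, hab, (h.lt_iff hab).2 (by grind)⟩, fun i hi j hj => (h i j hj).2 ?_⟩
    have := hw.before_one a i ha hi
    grind
  · rintro ⟨⟨b, hb, hba⟩, h₁⟩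
    rw [h.lt_iff hb] at hba
    obtain ⟨a', ha', ha1⟩ := hw.exists_one a (by grind)
    rcases ha'.lt_or_eq with hlt | rfl
    · obtain ⟨c, hc, hc0⟩ := hw.after_one a' ha1
      have hac : a' < c := by rw [Fin.lt_def]; omega
      have := (h _ _ hac).1 (h₁ a' hlt c hac)
      grind
    · exact ha1

lemma zero_iff (hw : IsCode w) (h : IsStandardization w π) {a : Fin n} (ha : w a = 1)
    (i : Fin n) : w i = 0 ↔ π i < π a := by
  constructor
  · intro hi
    exact h.lt_of_lt (by grind)
  · intro hi
    rcases lt_trichotomy i a with hlt | rfl | hlt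
    · exact hw.before_one a i ha hlt
    · exact absurd hi (lt_irrefl _)
    · rw [h.lt_iff hlt] at hi
      grind

lemma ne_two_of_eq_three (hw' : IsCode w') (h : IsStandardization w π) (h' : IsStandardization w' π)
    {i : Fin n} (hi : w i = 3) : w' i ≠ 2 := by
  intro hi'
  obtain ⟨j, hj, hj3⟩ := hw'.before_two i hi'
  have h₁ := (h j i hj).2 (by grind)
  rw [h' j i hj] at h₁
  grind

lemma eq_of_isStandardization (hw : IsCode w) (hw' : IsCode w') (h : IsStandardization w π)
    (h' : IsStandardization w' π) : w = w' := by
  have h1 : ∀ i, w i = 1 ↔ w' i = 1 := fun i => by rw [hw.one_iff h, hw'.one_iff h']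
  have h0 : ∀ i, w i = 0 ↔ w' i = 0 := fun i => by
    by_cases hex : ∃ a, w a = 1
    · obtain ⟨a, ha⟩ := hex
      rw [hw.zero_iff h ha, hw'.zero_iff h' ((h1 a).1 ha)]
    · have := hw.exists_one i
      have := hw'.exists_one i
      grind
  ext i
  have := h0 i
  have := h1 i
  have := ne_two_of_eq_three hw h' h (i := i)
  have := ne_two_of_eq_three hw' h h' (i := i)
  grind

end IsCode

section Encoding

variable {n : ℕ} {π : Equiv.Perm (Fin n)}

/-- The word of `π` relative to its first non-fixed position `a`: the letters record whether
an entry is smaller than, equal to or larger than `π a`, and in the last case whether it is a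
left-to-right maximum. -/
noncomputable def code (π : Equiv.Perm (Fin n)) (a i : Fin n) : Fin 4 :=
  open Classical in
  if π i < π a then 0 else if i = a then 1 else if ∃ j < i, π i < π j then 2 else 3

lemma exists_pred {x y : Fin n} (hxy : π y < π x) : ∃ j, (π x : ℕ) = π j + 1 ∧ π y ≤ π j := by
  rw [Fin.lt_def] at hxy
  refine ⟨π.symm ⟨π x - 1, by omega⟩, ?_, ?_⟩
  · simp; omega
  · rw [Fin.le_def]; simp; omega

lemma IsFishburn.exists_succ_lt (hF : IsFishburn π) {a b : Fin n} (hab : a < b) (hba : π b < π a)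
    (hfix : ∀ i < a, ∀ j > i, π i < π j) : ∃ a' : Fin n, (a' : ℕ) = a + 1 ∧ π a' < π a := by
  rw [isFishburn_iff] at hF
  obtain ⟨a', ha'⟩ : ∃ a' : Fin n, (a' : ℕ) = a + 1 :=
    ⟨⟨a + 1, by rw [Fin.lt_def] at hab; omega⟩, rfl⟩
  refine ⟨a', ha', ?_⟩
  obtain ⟨j, hj, hbj⟩ := exists_pred hba
  have hja : π j < π a := by rw [Fin.lt_def]; omega
  by_contra! hle
  have haj : a < j := by
    rcases lt_trichotomy j a with h | rfl | h
    · exact absurd (hfix j h b (h.trans hab)) hbj.not_gt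
    · exact absurd hja (lt_irrefl _)
    · exact h
  have hne : a' ≠ j := fun h => by rw [h] at hle; exact absurd hja hle.not_gt
  have haa' : a ≠ a' := fun h => by rw [h] at ha'; omega
  refine hF a a' j ha' (lt_of_le_of_ne ?_ hne)
    (lt_of_le_of_ne hle fun h => haa' (π.injective h)) hj
  rw [Fin.lt_def] at haj
  rw [Fin.le_def]
  omega

lemma code_eq_zero {a i : Fin n} : code π a i = 0 ↔ π i < π a := by
  simp only [code]; split_ifs <;> simp_all

lemma code_eq_one {a i : Fin n} : code π a i = 1 ↔ i = a := by
  simp only [code]; split_ifs <;> simp_all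
  all_goals grind

lemma code_eq_two {a i : Fin n} : code π a i = 2 ↔ π a < π i ∧ ∃ j < i, π i < π j := by
  rcases lt_trichotomy (π i) (π a) with h | h | h
  · simp [code, h, h.not_gt]
  · obtain rfl := π.injective h
    simp [code]
  · have hne : i ≠ a := fun he => h.ne (by rw [he])
    simp [code, h, h.not_gt, hne]

lemma code_eq_three {a i : Fin n} : code π a i = 3 ↔ π a < π i ∧ ∀ j < i, π j < π i := by
  rcases lt_trichotomy (π i) (π a) with h | h | h
  · simp [code, h, h.not_gt]
  · obtain rfl := π.injective h
    simp [code]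
  · have hne : i ≠ a := fun he => h.ne (by rw [he])
    simp only [code, h.not_gt, hne, h, if_false, true_and]
    have hle : (∀ j < i, π j < π i) ↔ ¬ ∃ j < i, π i < π j := by
      push Not
      exact forall₂_congr fun j hj =>
        ⟨le_of_lt, fun hle => lt_of_le_of_ne hle fun he => hj.ne (π.injective he)⟩
    rw [hle]
    split_ifs <;> simp_all

lemma isCode_code (hF : IsFishburn π) (h3 : Avoids π ![3, 2, 1]) (h5 : Avoids π ![2, 1, 3, 5, 4])
    {a a' : Fin n} (hfix : ∀ i < a, ∀ j > i, π i < π j) (ha' : (a' : ℕ) = a + 1)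
    (hπa' : π a' < π a) : IsCode (code π a) ∧ IsStandardization (code π a) π := by
  rw [isFishburn_iff] at hF
  rw [Avoids, contains_321_iff] at h3
  rw [Avoids, contains_21354_iff] at h5
  obtain ⟨w, hw⟩ : ∃ w, w = code π a := ⟨_, rfl⟩
  have w0 : ∀ i, w i = 0 ↔ π i < π a := fun i => hw ▸ code_eq_zero
  have w1 : ∀ i, w i = 1 ↔ i = a := fun i => hw ▸ code_eq_one
  have w2 : ∀ i, w i = 2 ↔ π a < π i ∧ ∃ j < i, π i < π j := fun i => hw ▸ code_eq_two
  have w3 : ∀ i, w i = 3 ↔ π a < π i ∧ ∀ j < i, π j < π i := fun i => hw ▸ code_eq_three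
  rw [← hw]
  clear hw
  have haa' : a < a' := by rw [Fin.lt_def]; omega
  have next : ∀ i, a < i → π a < π i → a' < i := fun i hi hπ => by
    have : i ≠ a' := by rintro rfl; exact absurd hπ hπa'.asymm
    rw [Fin.lt_def] at *
    have := Fin.val_ne_of_ne this
    omega
  have inj : ∀ i j, π i = π j → i = j := fun i j h => π.injective h
  have up : ∀ i, π a < π i → a < i := fun i h => by
    have := hfix i
    grind
  have cases4 : ∀ x : Fin 4, x = 0 ∨ x = 1 ∨ x = 2 ∨ x = 3 := by decide
  have up_lt : ∀ i j, i < j → π i < π j → w i ≤ w j := fun i j hij hπ => by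
    by_contra! hlt
    have hi : w i = 3 ∧ w j = 2 := by
      have := w0 i
      have := w0 j
      have := w1 i
      have := w1 j
      have := w2 i
      have := w3 i
      have := cases4 (w i)
      have := cases4 (w j)
      grind
    obtain ⟨h₁, l, hl, hjl⟩ := (w2 j).1 hi.2
    obtain ⟨h₂, h₄⟩ := (w3 i).1 hi.1
    have hil : i < l := by
      have := h₄ l
      grind
    exact h5 ⟨a, a', i, l, j, haa', next i (up i h₂) h₂, hil, hl, hπa', h₂, hπ, hjl⟩
  have down_lt : ∀ i j, i < j → π j < π i → w j < w i := fun i j hij hπ => by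
    rcases cases4 (w i) with h | h | h | h
    · rw [w0] at h
      rcases lt_trichotomy i a with hia | rfl | hia
      · exact absurd hπ (hfix i hia j hij).asymm
      · exact absurd h (lt_irrefl _)
      · exact absurd ⟨a, i, j, hia, hij, hπ, h⟩ h3
    · rw [w1] at h
      subst h
      rw [(w0 j).2 hπ, (w1 i).2 rfl]
      decide
    · obtain ⟨-, l, hl, hil⟩ := (w2 i).1 h
      exact absurd ⟨l, i, j, hl, hij, hπ, hil⟩ h3
    · have hj : w j ≠ 3 := fun e => (((w3 j).1 e).2 i hij).asymm hπ
      rw [h]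
      exact lt_of_le_of_ne (Fin.le_last _) hj
  have std : IsStandardization w π := fun i j hij => by
    refine ⟨up_lt i j hij, fun hle => ?_⟩
    by_contra! hπ
    exact absurd (down_lt i j hij (lt_of_le_of_ne hπ fun h => hij.ne' (inj _ _ h))) hle.not_gt
  have before_two : ∀ i, w i = 2 → ∃ j < i, w j = 3 := fun i hi => by
    obtain ⟨h₁, l, hl, hil⟩ := (w2 i).1 hi
    refine ⟨l, hl, (w3 l).2 ⟨h₁.trans hil, fun j hj => ?_⟩⟩
    by_contra! hle
    exact h3 ⟨j, l, i, hj, hl, hil, lt_of_le_of_ne hle fun h => hj.ne' (inj _ _ h)⟩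
  refine ⟨⟨?_, ?_, ?_, ?_, before_two, ?_, ?_, ?_⟩, std⟩
  · grind
  · intro i j hi hj
    obtain rfl := (w1 i).1 hi
    exact (w0 j).2 (hfix j hj i hj)
  · intro i hi
    refine ⟨a, ?_, (w1 a).2 rfl⟩
    by_contra! hia
    exact hi ((w0 i).2 (hfix i hia a hia))
  · intro i hi
    obtain rfl := (w1 i).1 hi
    exact ⟨a', ha', (w0 a').2 hπa'⟩
  · intro i j hij hi hj
    obtain ⟨h₁, l, hl, hil⟩ := (w2 i).1 hi
    exact h3 ⟨l, i, j, hl, hij, ((w0 j).1 hj).trans h₁, hil⟩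
  · intro i j k hij hjk hi hj hk
    have h₁ := ((w2 i).1 hi).1
    exact h5 ⟨a, a', i, j, k, haa', next i (up i h₁) h₁, hij, hjk, hπa', h₁,
      (std i k (hij.trans hjk)).2 (by rw [hi, hk]),
      (std.lt_iff hjk).2 (by rw [hj, hk]; decide)⟩
  · intro u v i huv hu hv hi
    by_contra! hfirst
    obtain ⟨j, hj, hij⟩ := exists_pred (std.lt_of_lt (i := i) (j := u) (by rw [hi, hu]; decide))
    have hju : π j < π u := by rw [Fin.lt_def]; omega
    have haj : π a < π j := ((w2 i).1 hi).1.trans_le hij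
    have huv' : u < v := by rw [Fin.lt_def]; omega
    have hj2 : w j = 2 := by
      have h0 : w j ≠ 0 := fun e => haj.asymm ((w0 j).1 e)
      have h1 : w j ≠ 1 := fun e => haj.ne (congrArg π ((w1 j).1 e).symm)
      have : w j ≠ 3 → w j = 2 := fun e => by simpa [h0, h1, e] using cases4 (w j)
      rcases lt_trichotomy j u with h | rfl | h
      · exact this (hfirst j h)
      · exact absurd hju (lt_irrefl _)
      · exact this fun e => by simpa [e, hu] using (std.lt_iff h).1 hju
    obtain ⟨l, hl, hl3⟩ := before_two j hj2
    have huj : u < j := by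
      by_contra! hle
      exact hfirst l (hl.trans_le hle) hl3
    have hvj : v ≠ j := by rintro rfl; simp [hj2] at hv
    refine hF u v j huv (lt_of_le_of_ne ?_ hvj) ((std u v huv').2 (by rw [hu, hv])) hj
    rw [Fin.lt_def] at huj
    rw [Fin.le_def]
    omega

lemma exists_isCode (hF : IsFishburn π) (h3 : Avoids π ![3, 2, 1])
    (h5 : Avoids π ![2, 1, 3, 5, 4]) : ∃ w, IsCode w ∧ IsStandardization w π := by
  by_cases hinv : ∃ a b, a < b ∧ π b < π a
  swap
  · push Not at hinv
    refine ⟨fun _ => 0, ?_, fun i j hij => ?_⟩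
    · constructor <;> simp
    · simpa using lt_of_le_of_ne (hinv i j hij) fun h => hij.ne (π.injective h)
  obtain ⟨a, ⟨b, hab, hba⟩, hmin⟩ := WellFounded.has_min (wellFounded_lt (α := Fin n))
    {a | ∃ b, a < b ∧ π b < π a} hinv
  have hfix : ∀ i < a, ∀ j > i, π i < π j := fun i hi j hj => by
    by_contra! hle
    exact hmin i ⟨j, hj, lt_of_le_of_ne hle fun h => hj.ne' (π.injective h)⟩ hi
  obtain ⟨a', ha', hπa'⟩ := hF.exists_succ_lt hab hba hfix
  exact ⟨_, isCode_code hF h3 h5 hfix ha' hπa'⟩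

end Encoding

section Counting

/-- The number of words of length `k` over `Fin 4` with property `P`. -/
noncomputable def wordCount (k : ℕ) (P : (Fin k → Fin 4) → Prop) : ℕ :=
  open Classical in #{w | P w}

lemma wordCount_zero {P : (Fin 0 → Fin 4) → Prop} (h : ∀ w, P w) : wordCount 0 P = 1 := by
  simp [wordCount, h]

lemma wordCount_succ {k : ℕ} (P : (Fin (k + 1) → Fin 4) → Prop) :
    wordCount (k + 1) P = ∑ c, wordCount k fun w => P (Fin.cons c w) := by
  classical
  simp only [wordCount, card_filter, ← Fintype.sum_prod_type']
  exact ((Fin.consEquiv fun _ : Fin (k + 1) => Fin 4).sum_comp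
    fun w => if P w then 1 else 0).symm

lemma wordCount_false {k : ℕ} : (wordCount k fun _ => False) = 0 := by
  simp [wordCount]

/-- Words over `{0, 3}`. -/
def IsBinary {k : ℕ} (w : Fin k → Fin 4) : Prop :=
  ∀ i, w i = 0 ∨ w i = 3

/-- Words of the form `2ᵗ 3ᵉ`. -/
def IsTail {k : ℕ} (w : Fin k → Fin 4) : Prop :=
  (∀ i, w i = 2 ∨ w i = 3) ∧ ∀ i j, i < j → w i = 3 → w j = 3

/-- Words of the form `W 2ᵗ 3ᵉ` with `W` over `{0, 3}`. -/
def IsLate {k : ℕ} (w : Fin k → Fin 4) : Prop :=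
  (∀ i, w i ≠ 1) ∧ (∀ i j, i < j → w i = 2 → w j ≠ 0) ∧
    ∀ i j l, i < j → j < l → w i = 2 → w j = 3 → w l ≠ 2

/-- Words that may follow the first `3` of a code. -/
def IsMiddle {k : ℕ} (w : Fin k → Fin 4) : Prop :=
  IsLate w ∧ ∀ i j : Fin k, (i : ℕ) = 0 → w i = 3 → w j ≠ 2

/-- Words that may follow the letters `1 0` of a code. -/
def IsEarly {k : ℕ} (w : Fin k → Fin 4) : Prop :=
  IsLate w ∧ (∀ i, w i = 2 → ∃ j < i, w j = 3) ∧
    ∀ u v i : Fin k, (v : ℕ) = u + 1 → w u = 3 → w v = 3 → w i = 2 → ∃ j < u, w j = 3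

/-- Words that may follow the letter `1` of a code. -/
def IsAfterOne {k : ℕ} (w : Fin k → Fin 4) : Prop :=
  IsEarly w ∧ ∃ b : Fin k, (b : ℕ) = 0 ∧ w b = 0

variable {k : ℕ} (w : Fin k → Fin 4)

lemma wordCount_isBinary : wordCount k IsBinary = 2 ^ k := by
  induction k with
  | zero => exact wordCount_zero fun w i => i.elim0
  | succ k ih =>
    have h : ∀ c, (fun w : Fin k → Fin 4 => IsBinary (Fin.cons c w : Fin (k + 1) → Fin 4)) =
        fun w => (c = 0 ∨ c = 3) ∧ IsBinary w := fun c => by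
      funext w; simp [IsBinary, Fin.forall_fin_succ]
    simp [wordCount_succ, h, Fin.sum_univ_four, wordCount_false, ih, pow_succ, mul_two]

lemma isTail_cons_three : IsTail (Fin.cons 3 w : Fin (k + 1) → Fin 4) ↔ ∀ i, w i = 3 := by
  simp [IsTail, Fin.forall_fin_succ]
  grind

lemma isTail_cons_two : IsTail (Fin.cons 2 w : Fin (k + 1) → Fin 4) ↔ IsTail w := by
  simp [IsTail, Fin.forall_fin_succ]

lemma wordCount_isTail : wordCount k IsTail = k + 1 := by
  induction k with
  | zero => exact wordCount_zero fun w => ⟨fun i => i.elim0, fun i => i.elim0⟩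
  | succ k ih =>
    have h0 (w : Fin k → Fin 4) : ¬ IsTail (Fin.cons 0 w : Fin (k + 1) → Fin 4) :=
      fun h => by simpa using h.1 0
    have h1 (w : Fin k → Fin 4) : ¬ IsTail (Fin.cons 1 w : Fin (k + 1) → Fin 4) :=
      fun h => by simpa using h.1 0
    have h3 : (wordCount k fun w => ∀ i, w i = 3) = 1 := by
      simp only [wordCount]
      rw [card_eq_one]
      exact ⟨fun _ => 3, by ext w; simp [funext_iff]⟩
    simp [wordCount_succ, Fin.sum_univ_four, h0, h1, isTail_cons_two, isTail_cons_three,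
      wordCount_false, ih, h3]

lemma isLate_cons_zero : IsLate (Fin.cons 0 w : Fin (k + 1) → Fin 4) ↔ IsLate w := by
  simp [IsLate, Fin.forall_fin_succ]

lemma isLate_cons_three : IsLate (Fin.cons 3 w : Fin (k + 1) → Fin 4) ↔ IsLate w := by
  simp [IsLate, Fin.forall_fin_succ]

lemma isLate_cons_two : IsLate (Fin.cons 2 w : Fin (k + 1) → Fin 4) ↔ IsTail w := by
  simp [IsLate, IsTail, Fin.forall_fin_succ]
  grind

lemma not_isLate_cons_one : ¬ IsLate (Fin.cons 1 w : Fin (k + 1) → Fin 4) :=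
  fun h => h.1 0 rfl

lemma wordCount_isLate : wordCount k IsLate + k + 2 = 3 * 2 ^ k := by
  induction k with
  | zero =>
    rw [wordCount_zero]
    · rfl
    · exact fun w => ⟨fun i => i.elim0, fun i => i.elim0, fun i => i.elim0⟩
  | succ k ih =>
    simp only [wordCount_succ, Fin.sum_univ_four, isLate_cons_zero, isLate_cons_two,
      isLate_cons_three, not_isLate_cons_one, wordCount_false, wordCount_isTail]
    have : (wordCount k fun w => IsLate w) + k + 2 = 3 * 2 ^ k := ih
    omega

lemma isMiddle_cons_zero : IsMiddle (Fin.cons 0 w : Fin (k + 1) → Fin 4) ↔ IsLate w := by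
  simp [IsMiddle, isLate_cons_zero, Fin.forall_fin_succ]

lemma isMiddle_cons_two : IsMiddle (Fin.cons 2 w : Fin (k + 1) → Fin 4) ↔ IsTail w := by
  simp [IsMiddle, isLate_cons_two, Fin.forall_fin_succ]

lemma isMiddle_cons_three : IsMiddle (Fin.cons 3 w : Fin (k + 1) → Fin 4) ↔ IsBinary w := by
  simp [IsMiddle, IsLate, IsBinary, Fin.forall_fin_succ]
  grind

lemma not_isMiddle_cons_one : ¬ IsMiddle (Fin.cons 1 w : Fin (k + 1) → Fin 4) :=
  fun h => not_isLate_cons_one w h.1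

lemma wordCount_isMiddle : wordCount k IsMiddle + 1 = 2 ^ (k + 1) := by
  cases k with
  | zero =>
    rw [wordCount_zero]
    · rfl
    · exact fun w => ⟨⟨fun i => i.elim0, fun i => i.elim0, fun i => i.elim0⟩, fun i => i.elim0⟩
  | succ k =>
    simp only [wordCount_succ, Fin.sum_univ_four, isMiddle_cons_zero, isMiddle_cons_two,
      isMiddle_cons_three, not_isMiddle_cons_one, wordCount_false, wordCount_isTail,
      wordCount_isBinary]
    have : (wordCount k fun w => IsLate w) + k + 2 = 3 * 2 ^ k := wordCount_isLate
    omega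

lemma isEarly_cons_zero : IsEarly (Fin.cons 0 w : Fin (k + 1) → Fin 4) ↔ IsEarly w := by
  simp [IsEarly, isLate_cons_zero, Fin.forall_fin_succ, Fin.exists_fin_succ]

lemma isEarly_cons_three : IsEarly (Fin.cons 3 w : Fin (k + 1) → Fin 4) ↔ IsMiddle w := by
  simp [IsEarly, IsMiddle, isLate_cons_three, Fin.forall_fin_succ, Fin.exists_fin_succ]

lemma not_isEarly_cons_one : ¬ IsEarly (Fin.cons 1 w : Fin (k + 1) → Fin 4) :=
  fun h => not_isLate_cons_one w h.1

lemma not_isEarly_cons_two : ¬ IsEarly (Fin.cons 2 w : Fin (k + 1) → Fin 4) := fun h => by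
  simpa using h.2.1 0 rfl

lemma wordCount_isEarly : wordCount k IsEarly + (k + 1) = 2 ^ (k + 1) := by
  induction k with
  | zero =>
    rw [wordCount_zero]
    · rfl
    · exact fun w => ⟨⟨fun i => i.elim0, fun i => i.elim0, fun i => i.elim0⟩,
        fun i => i.elim0, fun i => i.elim0⟩
  | succ k ih =>
    simp only [wordCount_succ, Fin.sum_univ_four, isEarly_cons_zero, not_isEarly_cons_two,
      isEarly_cons_three, not_isEarly_cons_one, wordCount_false]
    have : (wordCount k fun w => IsMiddle w) + 1 = 2 ^ (k + 1) := wordCount_isMiddle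
    have : (wordCount k fun w => IsEarly w) + (k + 1) = 2 ^ (k + 1) := ih
    omega

lemma isAfterOne_cons (c : Fin 4) :
    IsAfterOne (Fin.cons c w : Fin (k + 1) → Fin 4) ↔ c = 0 ∧ IsEarly w := by
  by_cases hc : c = 0
  · subst hc
    simp [IsAfterOne, isEarly_cons_zero]
  · simp [IsAfterOne, hc]

lemma wordCount_isAfterOne :
    wordCount (k + 1) IsAfterOne + (k + 1) = 2 ^ (k + 1) := by
  simp [wordCount_succ, Fin.sum_univ_four, isAfterOne_cons, wordCount_false, wordCount_isEarly]

lemma isCode_cons_zero : IsCode (Fin.cons 0 w : Fin (k + 1) → Fin 4) ↔ IsCode w := by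
  simp [isCode_iff, Fin.forall_fin_succ, Fin.exists_fin_succ]

lemma isCode_cons_one : IsCode (Fin.cons 1 w : Fin (k + 1) → Fin 4) ↔ IsAfterOne w := by
  simp [isCode_iff, IsAfterOne, IsEarly, IsLate, Fin.forall_fin_succ, Fin.exists_fin_succ]
  grind

lemma not_isCode_cons {c : Fin 4} (h0 : c ≠ 0) (h1 : c ≠ 1) :
    ¬ IsCode (Fin.cons c w : Fin (k + 1) → Fin 4) := fun h => by
  obtain ⟨a, ha, ha1⟩ := h.exists_one 0 h0
  obtain rfl : a = 0 := by simpa using ha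
  exact h1 ha1

lemma wordCount_isCode :
    wordCount (k + 1) IsCode + (k + 1).choose 2 + 1 = 2 ^ (k + 1) := by
  have step (m : ℕ) : wordCount (m + 1) IsCode = wordCount m IsCode + wordCount m IsAfterOne := by
    simp [wordCount_succ, Fin.sum_univ_four, isCode_cons_zero, isCode_cons_one,
      not_isCode_cons, wordCount_false]
  induction k with
  | zero =>
    rw [step, wordCount_zero, wordCount]
    · simp [IsAfterOne]
    · intro w
      constructor <;> exact fun i => i.elim0
  | succ k ih =>
    have hchoose : (k + 1 + 1).choose 2 = (k + 1) + (k + 1).choose 2 := by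
      rw [Nat.choose_succ_succ', Nat.choose_one_right]
    rw [step, hchoose]
    have := wordCount_isAfterOne (k := k)
    omega

end Counting

theorem fishburn_321_21354 (n : ℕ) (hn : 1 ≤ n) :
    ({π : Equiv.Perm (Fin n) | IsFishburn π ∧ Avoids π ![3, 2, 1] ∧ Avoids π ![2, 1, 3, 5, 4]}.ncard : ℤ) = 2 ^ n - n.choose 2 - 1 := by
  classical
  have himage : {π : Equiv.Perm (Fin n) | IsFishburn π ∧ Avoids π ![3, 2, 1] ∧
      Avoids π ![2, 1, 3, 5, 4]} = standardize '' {w | IsCode w} := by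
    ext π
    constructor
    · rintro ⟨h₁, h₂, h₃⟩
      obtain ⟨w, hw, hπ⟩ := exists_isCode h₁ h₂ h₃
      exact ⟨w, hw, (isStandardization_iff_eq.1 hπ).symm⟩
    · rintro ⟨w, hw, h⟩
      have hπ : IsStandardization w π := isStandardization_iff_eq.2 h.symm
      exact ⟨hw.isFishburn hπ, hw.avoids_321 hπ, hw.avoids_21354 hπ⟩
  have hinj : Set.InjOn standardize {w : Fin n → Fin 4 | IsCode w} := fun w hw w' hw' h =>
    IsCode.eq_of_isStandardization hw hw' (isStandardization_iff_eq.2 rfl)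
      (isStandardization_iff_eq.2 h)
  obtain ⟨k, rfl⟩ := Nat.exists_eq_add_of_le' hn
  have hcard : {w : Fin (k + 1) → Fin 4 | IsCode w}.ncard = wordCount (k + 1) IsCode := by
    rw [Set.ncard_eq_toFinset_card', wordCount]
    congr 1
    ext w
    simp
  rw [himage, hinj.ncard_image, hcard]
  have h := wordCount_isCode (k := k)
  zify at h
  linarith
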